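/- arXiv:1302.6501 — 7 statements merged into one kernel-verified Lean document; each statement's English description precedes it below -/
import Mathlib

section
/- Define $f(s) = \left(\frac12 - \frac1s + \frac{1}{e^s - 1}\right)\frac1s$ for $s > 0$. Then for every $s > 0$: (i) $f(s) = 2\sum_{k=1}^{\infty} \frac{1}{s^2 + 4\pi^2 k^2}$; (ii) $0 < f(s) \le 1/12$; (iii) $0 < s f(s) + \frac12 < 1$. -/
/-- The function appearing in Binet's integral formula for `log Γ`. -/
noncomputable def binetF (s : ℝ) : ℝ := (1 / 2 - 1 / s + 1 / (Real.exp s - 1)) * (1 / s)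

theorem ofReal_mul_I_div_two_pi_mem_integerComplement {s : ℝ} (hs : s ≠ 0) :
    (s * Complex.I / (2 * Real.pi) : ℂ) ∈ Complex.integerComplement := by
  rintro ⟨n, hn⟩
  have him := congrArg Complex.im hn
  have hI : (s * Complex.I / (2 * Real.pi) : ℂ) = ((s / (2 * Real.pi) : ℝ) : ℂ) * Complex.I := by
    push_cast
    ring
  rw [hI, Complex.im_ofReal_mul] at him
  rw [Complex.intCast_im, Complex.I_im, mul_one] at him
  exact div_ne_zero hs Real.two_pi_pos.ne' him.symm

theorem binetF_eq_tsum {s : ℝ} (hs : 0 < s) :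
    binetF s = 2 * ∑' k : ℕ, 1 / (s ^ 2 + 4 * Real.pi ^ 2 * ((k : ℝ) + 1) ^ 2) := by
  have hmem := ofReal_mul_I_div_two_pi_mem_integerComplement hs.ne'
  have hcot := cot_series_rep' hmem
  have hpi : (Real.pi : ℂ) ≠ 0 := Complex.ofReal_ne_zero.mpr Real.pi_ne_zero
  have hsC : (s : ℂ) ≠ 0 := Complex.ofReal_ne_zero.mpr hs.ne'
  have hterm (n : ℕ) :
      1 / ((s * Complex.I / (2 * Real.pi) : ℂ) - (n + 1))
        + 1 / ((s * Complex.I / (2 * Real.pi) : ℂ) + (n + 1))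
      = (-4 * Real.pi * s * Complex.I)
        * ((1 / (s ^ 2 + 4 * Real.pi ^ 2 * ((n : ℝ) + 1) ^ 2) : ℝ) : ℂ) := by
    have hpos : s ^ 2 + 4 * Real.pi ^ 2 * ((n : ℝ) + 1) ^ 2 ≠ 0 := by positivity
    have hden : (s ^ 2 + 4 * Real.pi ^ 2 * ((n : ℂ) + 1) ^ 2 : ℂ) ≠ 0 := by exact_mod_cast hpos
    have hprod : ((s * Complex.I / (2 * Real.pi) : ℂ) + (n + 1))
        * ((s * Complex.I / (2 * Real.pi) : ℂ) - (n + 1))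
        = -(s ^ 2 + 4 * Real.pi ^ 2 * ((n : ℂ) + 1) ^ 2) / (4 * Real.pi ^ 2) := by
      field_simp
      linear_combination 4 * (s : ℂ) ^ 2 * Complex.I_sq
    have hid := cotTerm_identity hmem n
    simp only [cotTerm] at hid
    rw [hid, hprod]
    push_cast
    field_simp
  simp_rw [hterm] at hcot
  rw [tsum_mul_left, ← Complex.ofReal_tsum, Complex.cot_pi_eq_exp_ratio] at hcot
  have hexp : Complex.exp (2 * Real.pi * Complex.I * (s * Complex.I / (2 * Real.pi)))
      = (((Real.exp s)⁻¹ : ℝ) : ℂ) := by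
    rw [← Real.exp_neg, Complex.ofReal_exp]
    congr 1
    field_simp
    push_cast
    linear_combination (s : ℂ) * Complex.I_sq
  rw [hexp] at hcot
  set S := ∑' k : ℕ, 1 / (s ^ 2 + 4 * Real.pi ^ 2 * ((k : ℝ) + 1) ^ 2)
  have hE : Real.exp s - 1 ≠ 0 := (sub_pos.mpr (Real.one_lt_exp_iff.mpr hs)).ne'
  have hE0 : Real.exp s ≠ 0 := Real.exp_ne_zero s
  have hratio : ((((Real.exp s)⁻¹ : ℝ) : ℂ) + 1)
      / (Complex.I * (1 - (((Real.exp s)⁻¹ : ℝ) : ℂ)))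
      = -Complex.I * ((1 + 2 / (Real.exp s - 1) : ℝ) : ℂ) := by
    have hreal : ((Real.exp s)⁻¹ + 1) / (1 - (Real.exp s)⁻¹) = 1 + 2 / (Real.exp s - 1) := by
      have : 1 - (Real.exp s)⁻¹ = (Real.exp s - 1) / Real.exp s := by field_simp
      rw [this]
      field_simp
      ring
    rw [← hreal, mul_comm Complex.I, ← div_div, Complex.div_I]
    push_cast
    ring
  have hinv : (1 / (s * Complex.I / (2 * Real.pi)) : ℂ)
      = -Complex.I * ((2 * Real.pi / s : ℝ) : ℂ) := by
    push_cast
    field_simp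
    linear_combination Complex.I_sq
  rw [hratio, hinv] at hcot
  have hreal : Real.pi * (1 + 2 / (Real.exp s - 1)) - 2 * Real.pi / s = 4 * Real.pi * s * S := by
    have h : ((Real.pi * (1 + 2 / (Real.exp s - 1)) - 2 * Real.pi / s : ℝ) : ℂ)
        = ((4 * Real.pi * s * S : ℝ) : ℂ) := by
      apply mul_left_cancel₀ (neg_ne_zero.mpr Complex.I_ne_zero)
      rw [Complex.ofReal_sub, Complex.ofReal_mul Real.pi]
      push_cast at hcot ⊢
      linear_combination hcot
    exact_mod_cast h
  have hcancel : 1 + 2 / (Real.exp s - 1) - 2 / s = 4 * s * S := by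
    apply mul_left_cancel₀ Real.pi_ne_zero
    linear_combination hreal
  have hS : S = (1 + 2 / (Real.exp s - 1) - 2 / s) / (4 * s) := by
    rw [hcancel]
    field_simp
  rw [hS, binetF]
  ring

theorem hasSum_one_div_four_pi_sq_mul_succ_sq :
    HasSum (fun k : ℕ ↦ 1 / (4 * Real.pi ^ 2 * ((k : ℝ) + 1) ^ 2)) (1 / 24) := by
  have h := (hasSum_nat_add_iff' 1).mpr hasSum_zeta_two
  have hsum : 1 / (4 * Real.pi ^ 2) * (Real.pi ^ 2 / 6 - ∑ i ∈ Finset.range 1, 1 / (i : ℝ) ^ 2)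
      = 1 / 24 := by
    have := Real.pi_ne_zero
    simp
    field_simp
    norm_num
  rw [← hsum]
  have hfun : (fun k : ℕ ↦ 1 / (4 * Real.pi ^ 2 * ((k : ℝ) + 1) ^ 2))
      = fun k : ℕ ↦ 1 / (4 * Real.pi ^ 2) * (1 / ((k + 1 : ℕ) : ℝ) ^ 2) := by
    ext k
    rw [one_div_mul_one_div, Nat.cast_succ]
  rw [hfun]
  exact h.mul_left _

theorem one_div_sq_add_le (s : ℝ) (k : ℕ) :
    1 / (s ^ 2 + 4 * Real.pi ^ 2 * ((k : ℝ) + 1) ^ 2)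
      ≤ 1 / (4 * Real.pi ^ 2 * ((k : ℝ) + 1) ^ 2) :=
  one_div_le_one_div_of_le (by positivity) (le_add_of_nonneg_left (sq_nonneg s))

theorem summable_one_div_sq_add (s : ℝ) :
    Summable fun k : ℕ ↦ 1 / (s ^ 2 + 4 * Real.pi ^ 2 * ((k : ℝ) + 1) ^ 2) :=
  hasSum_one_div_four_pi_sq_mul_succ_sq.summable.of_nonneg_of_le
    (fun _ ↦ by positivity) (one_div_sq_add_le s)

theorem binetF_pos {s : ℝ} (hs : 0 < s) : 0 < binetF s := by
  rw [binetF_eq_tsum hs]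
  have := (summable_one_div_sq_add s).tsum_pos (fun _ ↦ by positivity) 0 (by positivity)
  positivity

theorem binetF_le {s : ℝ} (hs : 0 < s) : binetF s ≤ 1 / 12 := by
  rw [binetF_eq_tsum hs]
  have := (summable_one_div_sq_add s).tsum_le_tsum (one_div_sq_add_le s)
    hasSum_one_div_four_pi_sq_mul_succ_sq.summable
  rw [hasSum_one_div_four_pi_sq_mul_succ_sq.tsum_eq] at this
  linarith

theorem mul_binetF_add_half_lt_one {s : ℝ} (hs : 0 < s) : s * binetF s + 1 / 2 < 1 := by
  have hlt : 1 / (Real.exp s - 1) < 1 / s :=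
    one_div_lt_one_div_of_lt hs (by linarith [Real.add_one_lt_exp hs.ne'])
  have hmul : s * binetF s = 1 / 2 - 1 / s + 1 / (Real.exp s - 1) := by
    rw [binetF, mul_left_comm, mul_one_div_cancel hs.ne', mul_one]
  linarith

/-- Properties of the Binet function: series expansion and bounds. -/
theorem binetF_props (s : ℝ) (hs : 0 < s) :
    binetF s = 2 * ∑' k : ℕ, 1 / (s ^ 2 + 4 * Real.pi ^ 2 * ((k : ℝ) + 1) ^ 2)
    ∧ (0 < binetF s ∧ binetF s ≤ 1 / 12)
    ∧ (0 < s * binetF s + 1 / 2 ∧ s * binetF s + 1 / 2 < 1) := by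
  have hpos := binetF_pos hs
  exact ⟨binetF_eq_tsum hs, ⟨hpos, binetF_le hs⟩, by positivity, mul_binetF_add_half_lt_one hs⟩
end

section
/- Let $\Psi = \Gamma'/\Gamma$ be the digamma function. For every real $x > 0$ one has $0 < x(\log x - \Psi(x)) \le 1$ and $0 < \log x - \Psi(x) - \frac{1}{2x} \le \frac{1}{12 x^2}$. -/
/-- The real digamma function `Ψ = Γ'/Γ`. -/
noncomputable def rdigamma (x : ℝ) : ℝ := deriv Real.Gamma x / Real.Gamma x

open Real Set Filter Topology

/-- A function tending to `0` at infinity that does not increase under `y ↦ y + 1` is nonnegative. -/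
lemma nonneg_of_map_add_one_le {f : ℝ → ℝ} (hlim : Tendsto f atTop (𝓝 0))
    (hstep : ∀ y, 0 < y → f (y + 1) ≤ f y) {x : ℝ} (hx : 0 < x) : 0 ≤ f x := by
  have hle : ∀ n : ℕ, f (x + n) ≤ f x := by
    intro n
    induction n with
    | zero => simp
    | succ n ih =>
      have h := hstep (x + n) (by positivity)
      rw [add_assoc] at h
      push_cast
      exact h.trans ih
  have ht : Tendsto (fun n : ℕ => x + (n : ℝ)) atTop atTop :=
    tendsto_atTop_add_const_left _ _ tendsto_natCast_atTop_atTop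
  exact le_of_tendsto (hlim.comp ht) (Eventually.of_forall hle)

lemma log_lt_half_sub_inv {u : ℝ} (hu : 1 < u) : log u < (u - u⁻¹) / 2 := by
  have hder : ∀ v : ℝ, 0 < v →
      HasDerivAt (fun v => (v - v⁻¹) / 2 - log v) ((1 - v⁻¹) ^ 2 / 2) v := by
    intro v hv
    refine ((((hasDerivAt_id v).sub (hasDerivAt_inv hv.ne')).div_const 2).sub
      (hasDerivAt_log hv.ne')).congr_deriv ?_
    field_simp
    ring
  have hmono : StrictMonoOn (fun v : ℝ => (v - v⁻¹) / 2 - log v) (Ici 1) := by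
    refine strictMonoOn_of_deriv_pos (convex_Ici 1) (fun v hv =>
      (hder v (zero_lt_one.trans_le hv)).continuousAt.continuousWithinAt) fun v hv => ?_
    rw [interior_Ici, mem_Ioi] at hv
    rw [(hder v (zero_lt_one.trans hv)).deriv]
    have : v⁻¹ < 1 := inv_lt_one_of_one_lt₀ hv
    have : 0 < 1 - v⁻¹ := by linarith
    positivity
  have h := hmono (mem_Ici.2 le_rfl) (mem_Ici.2 hu.le) hu
  norm_num at h
  linarith

lemma half_sub_inv_sub_log_le {u : ℝ} (hu : 1 ≤ u) :
    (u - u⁻¹) / 2 - log u ≤ ((u - 1) ^ 2 - (1 - u⁻¹) ^ 2) / 12 := by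
  have hder : ∀ v : ℝ, 0 < v →
      HasDerivAt (fun v => ((v - 1) ^ 2 - (1 - v⁻¹) ^ 2) / 12 - ((v - v⁻¹) / 2 - log v))
        ((v - 1) ^ 4 / (6 * v ^ 3)) v := by
    intro v hv
    refine ((((((hasDerivAt_id v).sub_const 1).pow 2).sub
      (((hasDerivAt_inv hv.ne').const_sub 1).pow 2)).div_const 12).sub
      ((((hasDerivAt_id v).sub (hasDerivAt_inv hv.ne')).div_const 2).sub
      (hasDerivAt_log hv.ne'))).congr_deriv ?_
    simp only [id_eq, Nat.cast_ofNat, Nat.add_one_sub_one, pow_one]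
    field_simp
    ring
  have hmono : MonotoneOn
      (fun v : ℝ => ((v - 1) ^ 2 - (1 - v⁻¹) ^ 2) / 12 - ((v - v⁻¹) / 2 - log v)) (Ici 1) := by
    refine monotoneOn_of_deriv_nonneg (convex_Ici 1) (fun v hv =>
      (hder v (zero_lt_one.trans_le hv)).continuousAt.continuousWithinAt) (fun v hv => ?_)
      fun v hv => ?_ <;> rw [interior_Ici, mem_Ioi] at hv
    · exact (hder v (zero_lt_one.trans hv)).differentiableAt.differentiableWithinAt
    · have hv0 : 0 < v := zero_lt_one.trans hv
      rw [(hder v hv0).deriv]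
      positivity
  have h := hmono (mem_Ici.2 le_rfl) (mem_Ici.2 hu) hu
  norm_num at h
  linarith

lemma log_add_one_sub_log_lt {x : ℝ} (hx : 0 < x) :
    log (x + 1) - log x < 1 / (2 * x) + 1 / (2 * (x + 1)) := by
  rw [← log_div (by positivity) hx.ne']
  refine (log_lt_half_sub_inv ((one_lt_div hx).2 (by linarith))).trans_eq ?_
  field_simp
  ring

lemma sub_le_log_add_one_sub_log {x : ℝ} (hx : 0 < x) :
    1 / (2 * x) + 1 / (2 * (x + 1)) - (1 / (12 * x ^ 2) - 1 / (12 * (x + 1) ^ 2)) ≤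
      log (x + 1) - log x := by
  rw [← log_div (by positivity) hx.ne']
  have h := half_sub_inv_sub_log_le ((one_le_div hx).2 (by linarith : x ≤ x + 1))
  have h₁ : ((x + 1) / x - ((x + 1) / x)⁻¹) / 2 = 1 / (2 * x) + 1 / (2 * (x + 1)) := by
    field_simp
    ring
  have h₂ : (((x + 1) / x - 1) ^ 2 - (1 - ((x + 1) / x)⁻¹) ^ 2) / 12 =
      1 / (12 * x ^ 2) - 1 / (12 * (x + 1) ^ 2) := by
    field_simp
    ring
  linarith

lemma differentiableAt_Gamma_of_pos {x : ℝ} (hx : 0 < x) : DifferentiableAt ℝ Gamma x :=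
  differentiableAt_Gamma fun m => (by linarith [m.cast_nonneg (α := ℝ)] : -(m : ℝ) < x).ne'

lemma hasDerivAt_log_Gamma {x : ℝ} (hx : 0 < x) :
    HasDerivAt (log ∘ Gamma) (rdigamma x) x :=
  (differentiableAt_Gamma_of_pos hx).hasDerivAt.log (Gamma_pos_of_pos hx).ne'

lemma log_Gamma_add_one {x : ℝ} (hx : 0 < x) :
    (log ∘ Gamma) (x + 1) = (log ∘ Gamma) x + log x := by
  simp only [Function.comp_apply, Gamma_add_one hx.ne',
    log_mul hx.ne' (Gamma_pos_of_pos hx).ne', add_comm]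

lemma rdigamma_add_one {x : ℝ} (hx : 0 < x) : rdigamma (x + 1) = rdigamma x + 1 / x := by
  have h₁ : HasDerivAt (fun y => (log ∘ Gamma) (y + 1)) (rdigamma (x + 1)) x :=
    (hasDerivAt_log_Gamma (by positivity)).comp_add_const x 1
  have h₂ : HasDerivAt (fun y => (log ∘ Gamma) y + log y) (rdigamma x + 1 / x) x := by
    rw [one_div]
    exact (hasDerivAt_log_Gamma hx).add (hasDerivAt_log hx.ne')
  refine h₁.unique (h₂.congr_of_eventuallyEq ?_)
  filter_upwards [eventually_gt_nhds hx] with y hy using log_Gamma_add_one hy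

lemma slope_log_Gamma_add_one {x : ℝ} (hx : 0 < x) :
    slope (log ∘ Gamma) x (x + 1) = log x := by
  rw [slope_def_field, log_Gamma_add_one hx]
  simp

lemma rdigamma_le_log {x : ℝ} (hx : 0 < x) : rdigamma x ≤ log x := by
  rw [← slope_log_Gamma_add_one hx]
  exact convexOn_log_Gamma.le_slope_of_hasDerivAt hx (mem_Ioi.2 (by positivity)) (by linarith)
    (hasDerivAt_log_Gamma hx)

lemma log_sub_rdigamma_le {x : ℝ} (hx : 0 < x) : log x - rdigamma x ≤ 1 / x := by
  have h : log x ≤ rdigamma (x + 1) := by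
    rw [← slope_log_Gamma_add_one hx]
    exact convexOn_log_Gamma.slope_le_of_hasDerivAt hx (mem_Ioi.2 (by positivity)) (by linarith)
      (hasDerivAt_log_Gamma (by positivity))
  rw [rdigamma_add_one hx] at h
  linarith

lemma tendsto_log_sub_rdigamma : Tendsto (fun x => log x - rdigamma x) atTop (𝓝 0) := by
  have h : Tendsto (fun x : ℝ => 1 / x) atTop (𝓝 0) := by
    simpa using tendsto_inv_atTop_zero (𝕜 := ℝ)
  refine tendsto_of_tendsto_of_tendsto_of_le_of_le' tendsto_const_nhds h ?_ ?_ <;>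
    filter_upwards [eventually_gt_atTop 0] with x hx
  · exact sub_nonneg.2 (rdigamma_le_log hx)
  · exact log_sub_rdigamma_le hx

lemma tendsto_log_sub_rdigamma_sub :
    Tendsto (fun x => log x - rdigamma x - 1 / (2 * x)) atTop (𝓝 0) := by
  have h : Tendsto (fun x : ℝ => 1 / (2 * x)) atTop (𝓝 0) := by
    simpa using (tendsto_inv_atTop_zero (𝕜 := ℝ)).mul_const (2⁻¹ : ℝ)
  simpa using tendsto_log_sub_rdigamma.sub h

lemma log_sub_rdigamma_sub_pos {x : ℝ} (hx : 0 < x) :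
    0 < log x - rdigamma x - 1 / (2 * x) := by
  have hstep : ∀ y : ℝ, 0 < y → log (y + 1) - rdigamma (y + 1) - 1 / (2 * (y + 1)) <
      log y - rdigamma y - 1 / (2 * y) := by
    intro y hy
    have h₁ := log_add_one_sub_log_lt hy
    have h₂ : 1 / y = 1 / (2 * y) + 1 / (2 * y) := by field_simp; norm_num
    rw [rdigamma_add_one hy]
    linarith
  exact (nonneg_of_map_add_one_le tendsto_log_sub_rdigamma_sub (fun y hy => (hstep y hy).le)
    (by positivity : 0 < x + 1)).trans_lt (hstep x hx)

lemma log_sub_rdigamma_sub_le {x : ℝ} (hx : 0 < x) :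
    log x - rdigamma x - 1 / (2 * x) ≤ 1 / (12 * x ^ 2) := by
  have hsq : Tendsto (fun x : ℝ => 1 / (12 * x ^ 2)) atTop (𝓝 0) := by
    simpa using ((tendsto_inv_atTop_zero (𝕜 := ℝ)).pow 2).mul_const (12⁻¹ : ℝ)
  have hlim := hsq.sub tendsto_log_sub_rdigamma_sub
  rw [sub_zero] at hlim
  refine sub_nonneg.1 (nonneg_of_map_add_one_le hlim (fun y hy => ?_) hx)
  have h₁ := sub_le_log_add_one_sub_log hy
  have h₂ : 1 / y = 1 / (2 * y) + 1 / (2 * y) := by field_simp; norm_num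
  rw [rdigamma_add_one hy]
  linarith

/-- Elementary bounds for `log x - Ψ(x)` on `(0,∞)`. -/
theorem digamma_log_bounds (x : ℝ) (hx : 0 < x) :
    (0 < x * (Real.log x - rdigamma x) ∧ x * (Real.log x - rdigamma x) ≤ 1)
    ∧ (0 < Real.log x - rdigamma x - 1 / (2 * x)
        ∧ Real.log x - rdigamma x - 1 / (2 * x) ≤ 1 / (12 * x ^ 2)) := by
  have hpos := log_sub_rdigamma_sub_pos hx
  have hhalf : 0 < 1 / (2 * x) := by positivity
  refine ⟨⟨mul_pos hx (by linarith), ?_⟩, hpos, log_sub_rdigamma_sub_le hx⟩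
  rw [mul_comm, ← le_div_iff₀ hx]
  exact log_sub_rdigamma_le hx
end

section
/- Define, for $X > -1$ and $Y \in \mathbb{R}$, $L(X,Y) = (1+X)\log(1+X) + Y\arctan\frac{Y}{2+X} - \big(1+\tfrac{X}{2}\big)\log\Big[\big(1+\tfrac{X}{2}\big)^2 + \tfrac{Y^2}{4}\Big]$. Let $\xi, \eta \in \mathbb{R}$ with $|\eta| < \pi/2$ and $e^{\xi} < 2\cos\eta$. Then $\sup_{X > -1,\, Y \in \mathbb{R}} \big(X\xi + Y\eta - L(X,Y)\big) = -\xi - \log(2\cos\eta - e^{\xi})$, and the supremum is attained at $X = \frac{e^{\xi} - \cos\eta}{\cos\eta - \frac12 e^{\xi}}$, $Y = \frac{\sin\eta}{\cos\eta - \frac12 e^{\xi}}$ (this point satisfies $X > -1$). -/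
/-- The function `L(X,Y)` from the large deviations analysis. -/
noncomputable def Lfun (X Y : ℝ) : ℝ :=
  (1 + X) * Real.log (1 + X) + Y * Real.arctan (Y / (2 + X))
    - (1 + X / 2) * Real.log ((1 + X / 2) ^ 2 + Y ^ 2 / 4)

theorem Real.cos_le_tangent_of_mem_Icc {η θ : ℝ} (hη : η ∈ Set.Icc (-(Real.pi / 2)) (Real.pi / 2))
    (hθ : θ ∈ Set.Icc (-(Real.pi / 2)) (Real.pi / 2)) :
    Real.cos η ≤ Real.cos θ - Real.sin θ * (η - θ) := by
  have hc := strictConcaveOn_cos_Icc.concaveOn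
  rcases lt_trichotomy η θ with hlt | rfl | hlt
  · have := hc.le_slope_of_hasDerivAt hη hθ hlt (Real.hasDerivAt_cos θ)
    rw [slope_def_field, le_div_iff₀ (by linarith)] at this
    linarith
  · simp
  · have := hc.slope_le_of_hasDerivAt hθ hη hlt (Real.hasDerivAt_cos θ)
    rw [slope_def_field, div_le_iff₀ (by linarith)] at this
    linarith

/-- `Lfun` in the polar coordinates `1 + X / 2 + i Y / 2 = r exp (i θ)`. -/
theorem Lfun_polar {r θ : ℝ} (hr : 0 < r) (hθ : θ ∈ Set.Ioo (-(Real.pi / 2)) (Real.pi / 2)) :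
    Lfun (2 * r * Real.cos θ - 2) (2 * r * Real.sin θ) =
      (2 * r * Real.cos θ - 1) * Real.log (2 * r * Real.cos θ - 1) + 2 * r * Real.sin θ * θ
        - 2 * r * Real.cos θ * Real.log r := by
  have htan : 2 * r * Real.sin θ / (2 + (2 * r * Real.cos θ - 2)) = Real.tan θ := by
    rw [add_sub_cancel, mul_div_mul_left _ _ (by positivity), Real.tan_eq_sin_div_cos]
  have hsq : (1 + (2 * r * Real.cos θ - 2) / 2) ^ 2 + (2 * r * Real.sin θ) ^ 2 / 4 = r ^ 2 := by
    linear_combination r ^ 2 * Real.sin_sq_add_cos_sq θ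
  rw [Lfun, htan, Real.arctan_tan hθ.1 hθ.2, hsq, Real.log_pow]
  ring_nf

theorem exists_polar_of_neg_one_lt {X : ℝ} (hX : -1 < X) (Y : ℝ) :
    ∃ r θ : ℝ, 0 < r ∧ θ ∈ Set.Ioo (-(Real.pi / 2)) (Real.pi / 2) ∧
      X = 2 * r * Real.cos θ - 2 ∧ Y = 2 * r * Real.sin θ := by
  set θ := Real.arctan (Y / (2 + X))
  have hθ : θ ∈ Set.Ioo (-(Real.pi / 2)) (Real.pi / 2) := Real.arctan_mem_Ioo _
  have hcos : 0 < Real.cos θ := Real.cos_pos_of_mem_Ioo hθ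
  have htan : Real.tan θ = Y / (2 + X) := Real.tan_arctan _
  have hX2 : 0 < 2 + X := by linarith
  refine ⟨(2 + X) / (2 * Real.cos θ), θ, by positivity, hθ, ?_, ?_⟩
  · field_simp
    ring
  · rw [Real.tan_eq_sin_div_cos, div_eq_div_iff hcos.ne' hX2.ne'] at htan
    field_simp
    linear_combination -htan

theorem legendre_pairing_le {ξ η X : ℝ} (hη : |η| < Real.pi / 2)
    (h : Real.exp ξ < 2 * Real.cos η) (hX : -1 < X) (Y : ℝ) :
    X * ξ + Y * η - Lfun X Y ≤ -ξ - Real.log (2 * Real.cos η - Real.exp ξ) := by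
  obtain ⟨r, θ, hr, hθ, rfl, rfl⟩ := exists_polar_of_neg_one_lt hX Y
  rw [Lfun_polar hr hθ]
  obtain ⟨a, ha⟩ : ∃ a, a = 2 * r * Real.cos θ - 1 := ⟨_, rfl⟩
  have ha0 : 0 < a := by linarith
  have hM : 0 < 2 * Real.cos η - Real.exp ξ := by linarith
  have hlog₁ := Real.log_le_sub_one_of_pos (show 0 < Real.exp ξ * r / a by positivity)
  rw [Real.log_div (by positivity) ha0.ne', Real.log_mul (by positivity) hr.ne',
    Real.log_exp] at hlog₁
  have hlog₂ : a * (ξ + Real.log r - Real.log a) ≤ Real.exp ξ * r - a := by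
    calc a * (ξ + Real.log r - Real.log a) ≤ a * (Real.exp ξ * r / a - 1) := by gcongr
      _ = Real.exp ξ * r - a := by field_simp
  have hlog₃ := Real.log_le_sub_one_of_pos (mul_pos hr hM)
  rw [Real.log_mul hr.ne' hM.ne'] at hlog₃
  have htangent := mul_le_mul_of_nonneg_left
    (Real.cos_le_tangent_of_mem_Icc ⟨(abs_lt.mp hη).1.le, (abs_lt.mp hη).2.le⟩
      (Set.Ioo_subset_Icc_self hθ)) (show 0 ≤ 2 * r by positivity)
  rw [← ha, show 2 * r * Real.cos θ = a + 1 by linarith]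
  rw [mul_sub, show 2 * r * Real.cos θ = a + 1 by linarith] at htangent
  linarith

/-- The Legendre dual of `L`: for `|η| < π/2` and `e^ξ < 2 cos η`, the supremum of
`Xξ + Yη - L(X,Y)` over `X > -1`, `Y ∈ ℝ` equals `-ξ - log(2 cos η - e^ξ)`, attained at
the explicit point. -/
theorem legendre_dual_L (ξ η : ℝ) (hη : |η| < Real.pi / 2)
    (h : Real.exp ξ < 2 * Real.cos η) :
    IsGreatest {v : ℝ | ∃ X Y : ℝ, -1 < X ∧ v = X * ξ + Y * η - Lfun X Y}
      (-ξ - Real.log (2 * Real.cos η - Real.exp ξ))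
    ∧ (-1 < (Real.exp ξ - Real.cos η) / (Real.cos η - Real.exp ξ / 2)
        ∧ ((Real.exp ξ - Real.cos η) / (Real.cos η - Real.exp ξ / 2)) * ξ
            + (Real.sin η / (Real.cos η - Real.exp ξ / 2)) * η
            - Lfun ((Real.exp ξ - Real.cos η) / (Real.cos η - Real.exp ξ / 2))
                (Real.sin η / (Real.cos η - Real.exp ξ / 2))
          = -ξ - Real.log (2 * Real.cos η - Real.exp ξ)) := by
  have hD : 0 < Real.cos η - Real.exp ξ / 2 := by linarith
  have hM : 0 < 2 * Real.cos η - Real.exp ξ := by linarith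
  set X := (Real.exp ξ - Real.cos η) / (Real.cos η - Real.exp ξ / 2) with hXdef
  set Y := Real.sin η / (Real.cos η - Real.exp ξ / 2) with hYdef
  obtain ⟨r, hr⟩ : ∃ r, r = (2 * Real.cos η - Real.exp ξ)⁻¹ := ⟨_, rfl⟩
  have hr0 : 0 < r := hr ▸ inv_pos.mpr hM
  have hrM : r * (2 * Real.cos η - Real.exp ξ) = 1 := hr ▸ inv_mul_cancel₀ hM.ne'
  have hX : X = 2 * r * Real.cos η - 2 := by
    rw [hXdef, div_eq_iff hD.ne']
    linear_combination -Real.cos η * hrM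
  have hY : Y = 2 * r * Real.sin η := by
    rw [hYdef, div_eq_iff hD.ne']
    linear_combination -Real.sin η * hrM
  have ha : 2 * r * Real.cos η - 1 = Real.exp ξ * r := by linear_combination hrM
  have hX1 : -1 < X := by
    have : 0 < Real.exp ξ * r := by positivity
    linarith
  have hval : X * ξ + Y * η - Lfun X Y = -ξ - Real.log (2 * Real.cos η - Real.exp ξ) := by
    have hlog : Real.log r = -Real.log (2 * Real.cos η - Real.exp ξ) := by
      rw [hr, Real.log_inv]
    rw [hX, hY, Lfun_polar hr0 (abs_lt.mp hη), ha,
      Real.log_mul (by positivity) hr0.ne', Real.log_exp]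
    linear_combination hlog + (ξ + Real.log r) * ha
  refine ⟨⟨⟨X, Y, hX1, hval.symm⟩, ?_⟩, hX1, hval⟩
  rintro v ⟨X', Y', hX', rfl⟩
  exact legendre_pairing_le hη h hX' Y'
end

section
/- Define $H_a : \mathbb{R}^2 \to \mathbb{R}\cup\{+\infty\}$ by $H_a(\xi,\eta) = -\xi - \log(2\cos\eta - e^{\xi})$ if $|\eta| < \pi/2$ and $2\cos\eta - e^{\xi} > 0$, and $H_a(\xi,\eta) = +\infty$ otherwise. Then for every $(\xi,\eta) \in \mathbb{R}^2$ with $(\xi,\eta) \neq (0,0)$: if $\xi < 0$ and $\eta = 0$, then $\lim_{\kappa \to +\infty} \kappa^{-1} H_a(\kappa\xi, \kappa\eta) = -\xi$; otherwise (i.e. if $\eta \neq 0$ or $\xi > 0$ or ($\xi = 0$ and $\eta \neq 0$)), $\kappa^{-1} H_a(\kappa\xi, \kappa\eta) \to +\infty$ as $\kappa \to +\infty$. -/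
open Filter

/-- The function `H_a : ℝ² → ℝ ∪ {+∞}`. -/
noncomputable def Ha (ξ η : ℝ) : EReal :=
  if |η| < Real.pi / 2 ∧ Real.exp ξ < 2 * Real.cos η then
    ((-ξ - Real.log (2 * Real.cos η - Real.exp ξ) : ℝ) : EReal)
  else ⊤

theorem tendsto_inv_mul_Ha_zero_right {ξ : ℝ} (hξ : ξ < 0) :
    Tendsto (fun κ : ℝ => ((κ⁻¹ : ℝ) : EReal) * Ha (κ * ξ) 0) atTop (nhds ((-ξ : ℝ) : EReal)) := by
  have hexp : Tendsto (fun κ : ℝ => Real.exp (κ * ξ)) atTop (nhds 0) :=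
    Real.tendsto_exp_atBot.comp (tendsto_id.atTop_mul_const_of_neg hξ)
  have hlog : Tendsto (fun κ : ℝ => Real.log (2 - Real.exp (κ * ξ))) atTop
      (nhds (Real.log (2 - 0))) :=
    (hexp.const_sub 2).log (by norm_num)
  have hlim : Tendsto (fun κ : ℝ => -ξ - κ⁻¹ * Real.log (2 - Real.exp (κ * ξ))) atTop
      (nhds (-ξ)) := by
    simpa using (tendsto_inv_atTop_zero.mul hlog).const_sub (-ξ)
  refine ((continuous_coe_real_ereal.tendsto _).comp hlim).congr' ?_
  filter_upwards [eventually_gt_atTop 0] with κ hκ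
  have hlt : Real.exp (κ * ξ) < 2 := by
    have := Real.exp_lt_one_iff.2 (mul_neg_of_pos_of_neg hκ hξ)
    linarith
  have hcond : |(0 : ℝ)| < Real.pi / 2 ∧ Real.exp (κ * ξ) < 2 * Real.cos 0 := by
    simp [hlt, Real.pi_pos]
  rw [Ha, if_pos hcond, ← EReal.coe_mul, Function.comp_apply, EReal.coe_eq_coe_iff,
    Real.cos_zero, mul_one]
  field_simp

theorem Ha_eq_top_of_pi_div_two_le_abs {ξ η : ℝ} (h : Real.pi / 2 ≤ |η|) : Ha ξ η = ⊤ :=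
  if_neg fun hc => hc.1.not_ge h

theorem Ha_eq_top_of_two_le_exp {ξ η : ℝ} (h : 2 ≤ Real.exp ξ) : Ha ξ η = ⊤ :=
  if_neg fun hc => by linarith [hc.2, Real.cos_le_one η]

theorem eventually_Ha_eq_top {ξ η : ℝ} (h : 0 < ξ ∨ η ≠ 0) :
    ∀ᶠ κ : ℝ in atTop, Ha (κ * ξ) (κ * η) = ⊤ := by
  rcases h with hξ | hη
  · have hexp : Tendsto (fun κ : ℝ => Real.exp (κ * ξ)) atTop atTop :=
      Real.tendsto_exp_atTop.comp (tendsto_id.atTop_mul_const hξ)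
    filter_upwards [hexp.eventually_ge_atTop 2] with κ hκ
    exact Ha_eq_top_of_two_le_exp hκ
  · have habs : Tendsto (fun κ : ℝ => κ * |η|) atTop atTop :=
      tendsto_id.atTop_mul_const (abs_pos.2 hη)
    filter_upwards [habs.eventually_ge_atTop (Real.pi / 2), eventually_ge_atTop 0] with κ hκ hκ0
    exact Ha_eq_top_of_pi_div_two_le_abs (by rwa [abs_mul, abs_of_nonneg hκ0])

/-- The recession function of `H_a`. -/
theorem recession_Ha (ξ η : ℝ) (hne : (ξ, η) ≠ (0, 0)) :
    (ξ < 0 ∧ η = 0 →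
      Tendsto (fun κ : ℝ => ((κ⁻¹ : ℝ) : EReal) * Ha (κ * ξ) (κ * η))
        atTop (nhds ((-ξ : ℝ) : EReal)))
    ∧ (¬(ξ < 0 ∧ η = 0) →
      Tendsto (fun κ : ℝ => ((κ⁻¹ : ℝ) : EReal) * Ha (κ * ξ) (κ * η))
        atTop (nhds ⊤)) := by
  constructor
  · rintro ⟨hξ, rfl⟩
    simpa using tendsto_inv_mul_Ha_zero_right hξ
  · intro hnot
    have h : 0 < ξ ∨ η ≠ 0 := by
      by_contra! hc
      obtain ⟨hξ, rfl⟩ := hc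
      exact hnot ⟨lt_of_le_of_ne hξ fun h0 => hne (by rw [h0]), rfl⟩
    refine tendsto_const_nhds.congr' ?_
    filter_upwards [eventually_Ha_eq_top h, eventually_gt_atTop 0] with κ hκ hκ0
    rw [hκ, EReal.coe_mul_top_of_pos (inv_pos.2 hκ0)]
end

section
/- Let $0 < T \le 1$ and define ${\mathcal J}(u) = u\log u - u + 1$ for $u > 0$, ${\mathcal J}(0) = 1$. Consider $\varphi_T(\gamma) := {\mathcal J}(1+\gamma) - {\mathcal J}(1-T+\gamma) - {\mathcal J}\big(1+\tfrac{\gamma}{2}\big) + {\mathcal J}\big(1-T+\tfrac{\gamma}{2}\big)$ for $\gamma \ge -(1-T)$. Then: (i) for every $\gamma > -(1-T)$, $\varphi_T'(\gamma) = \log\frac{1+\gamma}{1-T+\gamma} - \frac12\log\frac{1+\gamma/2}{1-T+\gamma/2} > 0$; (ii) $\varphi_T(-(1-T)) = \xi_T := {\mathcal J}(T) - 1 - {\mathcal J}\big(\tfrac{1+T}{2}\big) + {\mathcal J}\big(\tfrac{1-T}{2}\big)$ and $\lim_{\gamma\to\infty}\varphi_T(\gamma) = T\log 2$; consequently (iii)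 $\varphi_T$ is a strictly increasing continuous bijection from $[-(1-T), \infty)$ onto $[\xi_T, T\log 2)$, so for every $\xi \in [\xi_T, T\log 2)$ the equation $\varphi_T(\gamma) = \xi$ has a unique solution $\gamma \ge -(1-T)$. -/
open Filter

/-- The entropy function `𝒥(u) = u log u - u + 1` (with `𝒥(0) = 1`, since
`Real.log 0 = 0`). -/
noncomputable def Jr (u : ℝ) : ℝ := u * Real.log u - u + 1

/-- `φ_T(γ) = 𝒥(1+γ) - 𝒥(1-T+γ) - 𝒥(1+γ/2) + 𝒥(1-T+γ/2)`. -/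
noncomputable def phiT (T γ : ℝ) : ℝ :=
  Jr (1 + γ) - Jr (1 - T + γ) - Jr (1 + γ / 2) + Jr (1 - T + γ / 2)

/-- `ξ_T`. -/
noncomputable def xiT (T : ℝ) : ℝ :=
  Jr T - 1 - Jr ((1 + T) / 2) + Jr ((1 - T) / 2)

theorem continuous_Jr : Continuous Jr := by
  unfold Jr
  exact (Real.continuous_mul_log.sub continuous_id).add continuous_const

theorem hasDerivAt_Jr {x : ℝ} (hx : x ≠ 0) : HasDerivAt Jr (Real.log x) x := by
  have h := ((Real.hasDerivAt_mul_log hx).sub (hasDerivAt_id x)).add_const 1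
  rw [add_sub_cancel_right] at h
  exact h

theorem continuous_phiT (T : ℝ) : Continuous (phiT T) := by
  have := continuous_Jr
  unfold phiT
  fun_prop

theorem hasDerivAt_phiT {T γ : ℝ} (hT : 0 < T) (hT1 : T ≤ 1) (hγ : -(1 - T) < γ) :
    HasDerivAt (phiT T)
      (Real.log ((1 + γ) / (1 - T + γ)) -
        (1 / 2) * Real.log ((1 + γ / 2) / (1 - T + γ / 2))) γ := by
  have h1 : 1 + γ ≠ 0 := by linarith
  have h2 : 1 - T + γ ≠ 0 := by linarith
  have h3 : 1 + γ / 2 ≠ 0 := by linarith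
  have h4 : 1 - T + γ / 2 ≠ 0 := by linarith
  have hid := hasDerivAt_id γ
  have hhalf := hid.div_const 2
  have h := ((((hasDerivAt_Jr h1).comp γ (hid.const_add 1)).sub
    ((hasDerivAt_Jr h2).comp γ (hid.const_add (1 - T)))).sub
    ((hasDerivAt_Jr h3).comp γ (hhalf.const_add 1))).add
    ((hasDerivAt_Jr h4).comp γ (hhalf.const_add (1 - T)))
  rw [Real.log_div h1 h2, Real.log_div h3 h4]
  exact h.congr_deriv (by ring)

theorem phiT_deriv_pos {T γ : ℝ} (hT : 0 < T) (hT1 : T ≤ 1) (hγ : -(1 - T) < γ) :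
    0 < Real.log ((1 + γ) / (1 - T + γ)) -
      (1 / 2) * Real.log ((1 + γ / 2) / (1 - T + γ / 2)) := by
  have h2 : 0 < 1 - T + γ := by linarith
  have h3 : 0 < 1 + γ / 2 := by linarith
  have h4 : 0 < 1 - T + γ / 2 := by linarith
  have key : (1 + γ / 2) / (1 - T + γ / 2) < ((1 + γ) / (1 - T + γ)) ^ 2 := by
    rw [div_pow, div_lt_div_iff₀ h4 (by positivity)]
    have e : (1 + γ) ^ 2 * (1 - T + γ / 2) - (1 + γ / 2) * (1 - T + γ) ^ 2 =
        T * ((1 - T + γ) * (1 - T) + T * (1 - T + γ / 2)) := by ring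
    have : 0 < T * ((1 - T + γ) * (1 - T) + T * (1 - T + γ / 2)) :=
      mul_pos hT (add_pos_of_nonneg_of_pos
        (mul_nonneg h2.le (by linarith)) (mul_pos hT h4))
    linarith
  have h := Real.log_lt_log (div_pos h3 h4) key
  rw [Real.log_pow] at h
  push_cast at h
  linarith

theorem phiT_left_endpoint (T : ℝ) : phiT T (-(1 - T)) = xiT T := by
  have h0 : Jr 0 = 1 := by simp [Jr]
  unfold phiT xiT
  rw [show 1 + -(1 - T) = T by ring, show 1 - T + -(1 - T) = 0 by ring,
    show 1 + -(1 - T) / 2 = (1 + T) / 2 by ring,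
    show 1 - T + -(1 - T) / 2 = (1 - T) / 2 by ring, h0]

theorem tendsto_add_mul_log_one_add_div_atTop (a : ℝ) :
    Tendsto (fun x : ℝ => (x + a) * Real.log (1 + a / x)) atTop (nhds a) := by
  have h1 := Real.tendsto_mul_log_one_add_div_atTop a
  have h2 : Tendsto (fun x : ℝ => a * Real.log (1 + a / x)) atTop (nhds 0) := by
    have h3 : Tendsto (fun x : ℝ => 1 + a / x) atTop (nhds 1) := by
      simpa using (tendsto_const_nhds (x := a)).div_atTop tendsto_id |>.const_add (1 : ℝ)
    simpa using (h3.log one_ne_zero).const_mul a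
  simpa [add_mul] using h1.add h2

theorem add_mul_log_one_add_div {a x : ℝ} (hx : 0 < x) (hxa : 0 < x + a) :
    (x + a) * Real.log (1 + a / x) = (x + a) * Real.log (x + a) - (x + a) * Real.log x := by
  rw [show 1 + a / x = (x + a) / x by field_simp, Real.log_div hxa.ne' hx.ne']
  ring

theorem tendsto_phiT_atTop {T : ℝ} (hT1 : T ≤ 1) :
    Tendsto (phiT T) atTop (nhds (T * Real.log 2)) := by
  have hhalf : Tendsto (fun x : ℝ => x / 2) atTop atTop :=
    tendsto_id.atTop_div_const two_pos
  have hone := tendsto_add_mul_log_one_add_div_atTop 1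
  have hc := tendsto_add_mul_log_one_add_div_atTop (1 - T)
  have h := ((hone.sub hc).sub ((hone.comp hhalf).sub (hc.comp hhalf))).add_const
    (T * Real.log 2)
  rw [sub_self, zero_add] at h
  refine h.congr' ?_
  filter_upwards [eventually_gt_atTop 0] with x hx
  have hx2 : 0 < x / 2 := by positivity
  simp only [Function.comp_apply, phiT, Jr]
  rw [add_mul_log_one_add_div hx (by linarith), add_mul_log_one_add_div hx (by linarith),
    add_mul_log_one_add_div hx2 (by linarith), add_mul_log_one_add_div hx2 (by linarith),
    Real.log_div hx.ne' two_ne_zero, add_comm x 1, add_comm x (1 - T),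
    add_comm (x / 2) 1, add_comm (x / 2) (1 - T)]
  ring

theorem strictMonoOn_phiT {T : ℝ} (hT : 0 < T) (hT1 : T ≤ 1) :
    StrictMonoOn (phiT T) (Set.Ici (-(1 - T))) := by
  refine strictMonoOn_of_deriv_pos (convex_Ici _) (continuous_phiT T).continuousOn fun x hx => ?_
  rw [interior_Ici] at hx
  rw [(hasDerivAt_phiT hT hT1 hx).deriv]
  exact phiT_deriv_pos hT hT1 hx

/-- A continuous strictly increasing function on `[a, ∞)` with limit `L` at infinity maps
`[a, ∞)` bijectively onto `[f a, L)`. -/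
theorem StrictMonoOn.bijOn_Ici_Ico {f : ℝ → ℝ} {a L : ℝ} (hf : StrictMonoOn f (Set.Ici a))
    (hc : ContinuousOn f (Set.Ici a)) (hL : Tendsto f atTop (nhds L)) :
    Set.BijOn f (Set.Ici a) (Set.Ico (f a) L) := by
  refine ⟨fun x hx => ⟨hf.monotoneOn Set.self_mem_Ici hx hx, ?_⟩, hf.injOn, fun y hy => ?_⟩
  · have hx1 : x + 1 ∈ Set.Ici a := le_trans (Set.mem_Ici.1 hx) (le_add_of_nonneg_right zero_le_one)
    refine (hf hx hx1 (by linarith)).trans_le (ge_of_tendsto hL ?_)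
    filter_upwards [eventually_ge_atTop (x + 1)] with z hz
    exact hf.monotoneOn hx1 (le_trans hx1 hz) hz
  · obtain ⟨b, hyb, hab⟩ := ((hL.eventually_const_lt hy.2).and (eventually_ge_atTop a)).exists
    obtain ⟨x, hx, rfl⟩ :=
      intermediate_value_Icc hab (hc.mono Set.Icc_subset_Ici_self) ⟨hy.1, hyb.le⟩
    exact ⟨x, hx.1, rfl⟩

/-- Monotonicity and range of `φ_T`. -/
theorem phiT_props (T : ℝ) (hT : 0 < T) (hT1 : T ≤ 1) :
    (∀ γ : ℝ, -(1 - T) < γ →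
      HasDerivAt (phiT T)
        (Real.log ((1 + γ) / (1 - T + γ)) - (1 / 2) * Real.log ((1 + γ / 2) / (1 - T + γ / 2))) γ
      ∧ 0 < Real.log ((1 + γ) / (1 - T + γ)) - (1 / 2) * Real.log ((1 + γ / 2) / (1 - T + γ / 2)))
    ∧ phiT T (-(1 - T)) = xiT T
    ∧ Tendsto (phiT T) atTop (nhds (T * Real.log 2))
    ∧ StrictMonoOn (phiT T) (Set.Ici (-(1 - T)))
    ∧ ContinuousOn (phiT T) (Set.Ici (-(1 - T)))
    ∧ Set.BijOn (phiT T) (Set.Ici (-(1 - T))) (Set.Ico (xiT T) (T * Real.log 2))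
    ∧ ∀ ξ ∈ Set.Ico (xiT T) (T * Real.log 2),
        ∃! γ : ℝ, -(1 - T) ≤ γ ∧ phiT T γ = ξ := by
  have hmono := strictMonoOn_phiT hT hT1
  have hcont := (continuous_phiT T).continuousOn (s := Set.Ici (-(1 - T)))
  have hlim := tendsto_phiT_atTop hT1
  have hbij := hmono.bijOn_Ici_Ico hcont hlim
  rw [phiT_left_endpoint] at hbij
  refine ⟨fun γ hγ => ⟨hasDerivAt_phiT hT hT1 hγ, phiT_deriv_pos hT hT1 hγ⟩,
    phiT_left_endpoint T, hlim, hmono, hcont, hbij, fun ξ hξ => ?_⟩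
  obtain ⟨γ, hγ, rfl⟩ := hbij.surjOn hξ
  exact ⟨γ, ⟨hγ, rfl⟩, fun δ hδ => hbij.injOn hδ.1 hγ hδ.2⟩
end

section
/- For all real $\alpha, \beta > 0$, $\int_{-\infty}^{\infty} \frac{\alpha^2 \log(v^2 + \beta^2)}{v^2 + \alpha^2}\, dv = 2\pi\alpha\log(\alpha + \beta)$. -/
open MeasureTheory

/-- Integrals over the real line, rewritten by the substitution `v = α * tan θ`. -/
theorem integral_eq_integral_tan (g : ℝ → ℝ) {α : ℝ} (hα : 0 < α) :
    ∫ v : ℝ, g v = ∫ θ in (-(Real.pi / 2))..(Real.pi / 2),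
      α / Real.cos θ ^ 2 * g (α * Real.tan θ) := by
  have himage : (fun θ ↦ α * Real.tan θ) '' Set.Ioo (-(Real.pi / 2)) (Real.pi / 2) = Set.univ := by
    refine Set.eq_univ_of_forall fun v ↦ ⟨Real.arctan (v / α), Real.arctan_mem_Ioo _, ?_⟩
    simp only [Real.tan_arctan]
    field_simp
  have hinj : Set.InjOn (fun θ ↦ α * Real.tan θ) (Set.Ioo (-(Real.pi / 2)) (Real.pi / 2)) :=
    fun x hx y hy hxy ↦ Real.injOn_tan hx hy (mul_left_cancel₀ hα.ne' hxy)
  have hderiv : ∀ θ ∈ Set.Ioo (-(Real.pi / 2)) (Real.pi / 2),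
      HasDerivWithinAt (fun θ ↦ α * Real.tan θ) (α * (1 / Real.cos θ ^ 2))
        (Set.Ioo (-(Real.pi / 2)) (Real.pi / 2)) θ :=
    fun θ hθ ↦ ((Real.hasDerivAt_tan_of_mem_Ioo hθ).const_mul α).hasDerivWithinAt
  rw [← setIntegral_univ, ← himage,
    integral_image_eq_integral_abs_deriv_smul measurableSet_Ioo hderiv hinj,
    intervalIntegral.integral_of_le (by linarith [Real.pi_pos]), integral_Ioc_eq_integral_Ioo]
  refine setIntegral_congr_fun measurableSet_Ioo fun θ _ ↦ ?_
  have : 0 ≤ α / Real.cos θ ^ 2 := by positivity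
  simp only [mul_one_div, abs_of_nonneg this, smul_eq_mul]

/-- A circle average over the unit circle, parametrised by half the angle. -/
theorem integral_circleMap_two_mul (f : ℂ → ℝ) :
    ∫ θ in (-(Real.pi / 2))..(Real.pi / 2), f (circleMap 0 1 (2 * θ)) =
      Real.pi * Real.circleAverage f 0 1 := by
  rw [intervalIntegral.integral_comp_mul_left (fun t ↦ f (circleMap 0 1 t)) two_ne_zero,
    Real.circleAverage_eq_integral_add (-Real.pi),
    intervalIntegral.integral_comp_add_right (fun t ↦ f (circleMap 0 1 t))]
  have h₁ : 2 * -(Real.pi / 2) = 0 + -Real.pi := by ring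
  have h₂ : 2 * (Real.pi / 2) = 2 * Real.pi + -Real.pi := by ring
  rw [h₁, h₂]
  simp only [smul_eq_mul]
  field_simp

theorem norm_circleMap_two_mul_add_ofReal_sq (c θ : ℝ) :
    ‖circleMap 0 1 (2 * θ) + (c : ℂ)‖ ^ 2 =
      (1 + c) ^ 2 * Real.cos θ ^ 2 + (1 - c) ^ 2 * Real.sin θ ^ 2 := by
  have hre : (circleMap 0 1 (2 * θ)).re = Real.cos (2 * θ) := by
    rw [circleMap_zero, ← Complex.exp_ofReal_mul_I_re]; simp
  have him : (circleMap 0 1 (2 * θ)).im = Real.sin (2 * θ) := by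
    rw [circleMap_zero, ← Complex.exp_ofReal_mul_I_im]; simp
  rw [Complex.sq_norm, Complex.normSq_apply, Complex.add_re, Complex.add_im, hre, him,
    Complex.ofReal_re, Complex.ofReal_im, Real.cos_two_mul, Real.sin_two_mul]
  linear_combination (4 * Real.cos θ ^ 2 - (1 - c) ^ 2) * Real.sin_sq_add_cos_sq θ

/-- On the unit circle the logarithm of a quadratic in `tan θ` is a combination of
logarithms of distances. -/
theorem log_tan_quadratic {α β θ : ℝ} (hα : 0 < α) (hβ : 0 < β) (hθ : Real.cos θ ≠ 0) :
    Real.log ((α * Real.tan θ) ^ 2 + β ^ 2) =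
      2 * Real.log (α + β)
        + 2 * (Real.log ‖circleMap 0 1 (2 * θ) + (((β - α) / (β + α) : ℝ) : ℂ)‖
          - Real.log ‖circleMap 0 1 (2 * θ) + ((1 : ℝ) : ℂ)‖) := by
  have hsum : β + α ≠ 0 := by positivity
  set p := ‖circleMap 0 1 (2 * θ) + (((β - α) / (β + α) : ℝ) : ℂ)‖ with hp
  set q := ‖circleMap 0 1 (2 * θ) + ((1 : ℝ) : ℂ)‖ with hq
  have hp2 : p ^ 2 = 4 * (β ^ 2 * Real.cos θ ^ 2 + α ^ 2 * Real.sin θ ^ 2) / (β + α) ^ 2 := by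
    rw [hp, norm_circleMap_two_mul_add_ofReal_sq]
    field_simp
    ring
  have hq2 : q ^ 2 = 4 * Real.cos θ ^ 2 := by
    rw [hq, norm_circleMap_two_mul_add_ofReal_sq]
    ring
  have hp0 : p ≠ 0 := by
    have : 0 < p ^ 2 := by rw [hp2]; positivity
    exact fun h ↦ by simp [h] at this
  have hq0 : q ≠ 0 := by
    have : 0 < q ^ 2 := by rw [hq2]; positivity
    exact fun h ↦ by simp [h] at this
  have hkey : (α * Real.tan θ) ^ 2 + β ^ 2 = ((α + β) * (p / q)) ^ 2 := by
    rw [mul_pow, mul_pow, div_pow, hp2, hq2, Real.tan_eq_sin_div_cos]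
    field_simp
    ring
  rw [hkey, Real.log_pow, Real.log_mul (by positivity) (div_ne_zero hp0 hq0),
    Real.log_div hp0 hq0]
  push_cast
  ring

/-- The mean of `log ‖z + c‖` over the unit circle vanishes for `‖c‖ ≤ 1`. -/
theorem circleAverage_log_norm_add_eq_zero {c : ℂ} (hc : ‖c‖ ≤ 1) :
    Real.circleAverage (fun z ↦ Real.log ‖z + c‖) 0 1 = 0 := by
  rw [circleAverage_log_norm_add_const_eq_posLog, Real.posLog_eq_zero_iff]
  simpa using hc

theorem circleIntegrable_log_norm_add (c : ℂ) :
    CircleIntegrable (fun z ↦ Real.log ‖z + c‖) 0 1 := by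
  simpa using circleIntegrable_log_norm_sub_const (a := -c) (c := 0) 1

theorem circleAverage_const_add_log_norm_sub_log_norm {c d : ℂ} (hc : ‖c‖ ≤ 1) (hd : ‖d‖ ≤ 1)
    (a b : ℝ) :
    Real.circleAverage (fun z ↦ a + b * (Real.log ‖z + c‖ - Real.log ‖z + d‖)) 0 1 = a := by
  have hsub := (circleIntegrable_log_norm_add c).sub (circleIntegrable_log_norm_add d)
  change Real.circleAverage ((fun _ ↦ a) +
    b • ((fun z ↦ Real.log ‖z + c‖) - fun z ↦ Real.log ‖z + d‖)) 0 1 = a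
  rw [Real.circleAverage_add (circleIntegrable_const _ _ _) hsub.const_smul,
    Real.circleAverage_smul,
    Real.circleAverage_sub (circleIntegrable_log_norm_add c) (circleIntegrable_log_norm_add d),
    circleAverage_log_norm_add_eq_zero hc, circleAverage_log_norm_add_eq_zero hd,
    Real.circleAverage_const]
  simp

/-- `∫ℝ α² log(v² + β²)/(v² + α²) dv = 2πα log(α+β)`. -/
theorem integral_log_quadratic (α β : ℝ) (hα : 0 < α) (hβ : 0 < β) :
    ∫ v : ℝ, α ^ 2 * Real.log (v ^ 2 + β ^ 2) / (v ^ 2 + α ^ 2)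
      = 2 * Real.pi * α * Real.log (α + β) := by
  have hc : ‖(((β - α) / (β + α) : ℝ) : ℂ)‖ ≤ 1 := by
    rw [Complex.norm_real, Real.norm_eq_abs, abs_div, abs_of_pos (by positivity : 0 < β + α),
      div_le_one (by positivity), abs_le]
    constructor <;> linarith
  have hd : ‖((1 : ℝ) : ℂ)‖ ≤ 1 := by simp
  rw [integral_eq_integral_tan _ hα]
  calc
    _ = ∫ θ in (-(Real.pi / 2))..(Real.pi / 2), α * (2 * Real.log (α + β)
        + 2 * (Real.log ‖circleMap 0 1 (2 * θ) + (((β - α) / (β + α) : ℝ) : ℂ)‖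
          - Real.log ‖circleMap 0 1 (2 * θ) + ((1 : ℝ) : ℂ)‖)) := by
      have hle : -(Real.pi / 2) ≤ Real.pi / 2 := by linarith [Real.pi_pos]
      rw [intervalIntegral.integral_of_le hle, intervalIntegral.integral_of_le hle,
        integral_Ioc_eq_integral_Ioo, integral_Ioc_eq_integral_Ioo]
      refine setIntegral_congr_fun measurableSet_Ioo fun θ hθ ↦ ?_
      have hcos : Real.cos θ ≠ 0 := (Real.cos_pos_of_mem_Ioo hθ).ne'
      have hden : (α * Real.tan θ) ^ 2 + α ^ 2 = α ^ 2 / Real.cos θ ^ 2 := by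
        rw [Real.tan_eq_sin_div_cos]
        field_simp
        exact Real.sin_sq_add_cos_sq θ
      rw [← log_tan_quadratic hα hβ hcos, hden]
      field_simp
    _ = 2 * Real.pi * α * Real.log (α + β) := by
      rw [intervalIntegral.integral_const_mul,
        integral_circleMap_two_mul fun z ↦ 2 * Real.log (α + β)
          + 2 * (Real.log ‖z + (((β - α) / (β + α) : ℝ) : ℂ)‖ - Real.log ‖z + ((1 : ℝ) : ℂ)‖),
        circleAverage_const_add_log_norm_sub_log_norm hc hd]
      ring
end

section
/- For every integer $k \ge 1$, the set $E_k$ of $k \times k$ complex matrices having no eigenvalue in the real interval $[1, \infty)$ is an open and connected subset of the space of all $k \times k$ complex matrices. -/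
/-- With `s = x⁻¹`, having no eigenvalue in `[1, ∞)` means that `1 - s V` is invertible
for all `s ∈ [0, 1]`. -/
theorem forall_det_smul_one_sub_ne_zero_iff {n : Type*} [Fintype n] [DecidableEq n]
    (V : Matrix n n ℂ) :
    (∀ x : ℝ, 1 ≤ x → Matrix.det ((x : ℂ) • (1 : Matrix n n ℂ) - V) ≠ 0) ↔
      ∀ s ∈ Set.Icc (0 : ℝ) 1, Matrix.det (1 - s • V) ≠ 0 := by
  have key (x : ℝ) (hx : x ≠ 0) :
      Matrix.det ((x : ℂ) • (1 : Matrix n n ℂ) - V) ≠ 0 ↔ Matrix.det (1 - x⁻¹ • V) ≠ 0 := by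
    have h : (x : ℂ) • (1 : Matrix n n ℂ) - V = (x : ℂ) • (1 - x⁻¹ • V) := by
      rw [smul_sub, Complex.coe_smul, Complex.coe_smul, smul_inv_smul₀ hx]
    rw [h, Matrix.det_smul]
    simp [hx]
  constructor
  · rintro h s ⟨hs0, hs1⟩
    rcases hs0.eq_or_lt with rfl | hs
    · simp
    · simpa using (key s⁻¹ (inv_ne_zero hs.ne')).1 (h _ ((one_le_inv₀ hs).2 hs1))
  · intro h x hx
    have hx0 : 0 < x := by linarith
    exact (key x hx0.ne').2 (h _ ⟨(inv_pos.2 hx0).le, inv_le_one_of_one_le₀ hx⟩)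

theorem isOpen_setOf_forall_det_one_sub_smul_ne_zero (n : Type*) [Fintype n] [DecidableEq n] :
    IsOpen {V : Matrix n n ℂ | ∀ s ∈ Set.Icc (0 : ℝ) 1, Matrix.det (1 - s • V) ≠ 0} := by
  rw [isOpen_iff_eventually]
  intro V hV
  refine isCompact_Icc.eventually_forall_of_forall_eventually fun s hs => ?_
  have hc : Continuous fun p : Matrix n n ℂ × ℝ => Matrix.det (1 - p.2 • p.1) := by fun_prop
  exact hc.continuousAt.eventually_ne (hV s hs)

theorem starConvex_setOf_forall_det_one_sub_smul_ne_zero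
    (n : Type*) [Fintype n] [DecidableEq n] :
    StarConvex ℝ 0 {V : Matrix n n ℂ | ∀ s ∈ Set.Icc (0 : ℝ) 1, Matrix.det (1 - s • V) ≠ 0} := by
  rw [starConvex_zero_iff]
  intro V hV t ht0 ht1 s hs
  rw [smul_smul]
  exact hV _ ⟨mul_nonneg hs.1 ht0, mul_le_one₀ hs.2 ht0 ht1⟩

/-- The set `E_k` of `k × k` complex matrices with no eigenvalue in `[1, ∞)`
(i.e. no root of `z ↦ det(zI - V)` in `[1, ∞)`) is open and connected. -/
theorem Ek_open_connected (k : ℕ) (hk : 1 ≤ k) :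
    IsOpen {V : Matrix (Fin k) (Fin k) ℂ |
        ∀ x : ℝ, 1 ≤ x → Matrix.det ((x : ℂ) • (1 : Matrix (Fin k) (Fin k) ℂ) - V) ≠ 0}
    ∧ IsConnected {V : Matrix (Fin k) (Fin k) ℂ |
        ∀ x : ℝ, 1 ≤ x → Matrix.det ((x : ℂ) • (1 : Matrix (Fin k) (Fin k) ℂ) - V) ≠ 0} := by
  simp only [forall_det_smul_one_sub_ne_zero_iff]
  exact ⟨isOpen_setOf_forall_det_one_sub_smul_ne_zero _,
    ((starConvex_setOf_forall_det_one_sub_smul_ne_zero _).isPathConnected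
      (by simp)).isConnected⟩
end
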